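/- arXiv:1907.03825 — 3 statements merged into one kernel-verified Lean document; each statement's English description precedes it below -/
import Mathlib

section
/- Let X be a real Banach space, Z ⊆ [a,b], and f : [a,b] → X any function. If the indicator function 𝟙_Z is McShane integrable on [a,b] with (M)∫_{[a,b]} 𝟙_Z = 0, then f·𝟙_Z is strongly McShane integrable on [a,b] with (M)∫_{[a,b]} f·𝟙_Z = θ, where θ is the zero vector of X. -/
open Set MeasureTheory

variable {E : Type*} [MeasureSpace E] [PseudoMetricSpace E] [Preorder E]
variable {X : Type*} [NormedAddCommGroup X] [NormedSpace ℝ X]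

/-- The closed interval of a tagged item `(t, p, q)` is `[p, q]` (the tag is `t`). -/
def itemBox (x : E × E × E) : Set E := Set.Icc x.2.1 x.2.2

/-- `[p,q]` is a closed non-degenerate subinterval of `K`. -/
def IsSubinterval (K : Set E) (p q : E) : Prop :=
  Set.Icc p q ⊆ K ∧ (interior (Set.Icc p q)).Nonempty

/-- `P` is an `𝓜`-partition of `K`: a finite collection of tagged pairwise
non-overlapping closed non-degenerate subintervals of `K` covering `K`, with tags in `K`. -/
def IsMPartition (K : Set E) (P : Finset (E × E × E)) : Prop :=
  (∀ x ∈ P, x.1 ∈ K ∧ IsSubinterval K x.2.1 x.2.2) ∧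
  (∀ x ∈ P, ∀ y ∈ P, x ≠ y → interior (itemBox x) ∩ interior (itemBox y) = ∅) ∧
  (⋃ x ∈ P, itemBox x) = K

/-- `𝓗𝓚`-partition: an `𝓜`-partition each of whose tags belongs to its interval. -/
def IsHKPartition (K : Set E) (P : Finset (E × E × E)) : Prop :=
  IsMPartition K P ∧ ∀ x ∈ P, x.1 ∈ itemBox x

/-- A gauge on `K`: positive on `K`. -/
def IsGauge (K : Set E) (δ : E → ℝ) : Prop := ∀ t ∈ K, 0 < δ t

/-- A tagged partition is `δ`-fine if each interval lies in the open ball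
around its tag of radius `δ(tag)`. -/
def IsFine (δ : E → ℝ) (P : Finset (E × E × E)) : Prop :=
  ∀ x ∈ P, itemBox x ⊆ Metric.ball x.1 (δ x.1)

/-- `f` is McShane integrable on `K` with integral `v`. -/
def HasMcShaneIntegral (K : Set E) (f : E → X) (v : X) : Prop :=
  ∀ ε > 0, ∃ δ : E → ℝ, IsGauge K δ ∧
    ∀ P : Finset (E × E × E), IsMPartition K P → IsFine δ P →
      ‖(∑ x ∈ P, (volume (itemBox x)).toReal • f x.1) - v‖ < ε

/-- `f` is Henstock–Kurzweil integrable on `K` with integral `v`. -/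
def HasHKIntegral (K : Set E) (f : E → X) (v : X) : Prop :=
  ∀ ε > 0, ∃ δ : E → ℝ, IsGauge K δ ∧
    ∀ P : Finset (E × E × E), IsHKPartition K P → IsFine δ P →
      ‖(∑ x ∈ P, (volume (itemBox x)).toReal • f x.1) - v‖ < ε

/-- An additive interval function on the non-degenerate closed subintervals of `K`
(an interval is recorded by its pair of corners). -/
def IsAdditiveIntervalFun (K : Set E) (F : E × E → X) : Prop :=
  ∀ p q r s u w : E, IsSubinterval K p q → IsSubinterval K r s → IsSubinterval K u w →
    interior (Set.Icc p q) ∩ interior (Set.Icc r s) = ∅ →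
    Set.Icc p q ∪ Set.Icc r s = Set.Icc u w →
    F (u, w) = F (p, q) + F (r, s)

/-- `f` is strongly McShane integrable on `[a,b]` with `(M)∫_{[a,b]} f = v`. -/
def HasStrongMcShaneIntegral (a b : E) (f : E → X) (v : X) : Prop :=
  ∃ F : E × E → X, IsAdditiveIntervalFun (Set.Icc a b) F ∧ F (a, b) = v ∧
    ∀ ε > 0, ∃ δ : E → ℝ, IsGauge (Set.Icc a b) δ ∧
      ∀ P : Finset (E × E × E), IsMPartition (Set.Icc a b) P → IsFine δ P →
        ∑ x ∈ P, ‖(volume (itemBox x)).toReal • f x.1 - F (x.2.1, x.2.2)‖ < ε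

/-- `f` is strongly Henstock–Kurzweil integrable on `[a,b]` with `(HK)∫_{[a,b]} f = v`. -/
def HasStrongHKIntegral (a b : E) (f : E → X) (v : X) : Prop :=
  ∃ F : E × E → X, IsAdditiveIntervalFun (Set.Icc a b) F ∧ F (a, b) = v ∧
    ∀ ε > 0, ∃ δ : E → ℝ, IsGauge (Set.Icc a b) δ ∧
      ∀ P : Finset (E × E × E), IsHKPartition (Set.Icc a b) P → IsFine δ P →
        ∑ x ∈ P, ‖(volume (itemBox x)).toReal • f x.1 - F (x.2.1, x.2.2)‖ < ε

/-- Property `𝓢*𝓜` on `[a,b]`. -/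
def PropSM (a b : E) (f : E → X) : Prop :=
  ∀ ε > 0, ∃ δ : E → ℝ, IsGauge (Set.Icc a b) δ ∧
    ∀ P Q : Finset (E × E × E),
      IsMPartition (Set.Icc a b) P → IsFine δ P →
      IsMPartition (Set.Icc a b) Q → IsFine δ Q →
      ∑ x ∈ P, ∑ y ∈ Q, ‖f x.1 - f y.1‖ * (volume (itemBox x ∩ itemBox y)).toReal < ε

/-- Property `𝓢*𝓗𝓚` on `[a,b]`. -/
def PropSHK (a b : E) (f : E → X) : Prop :=
  ∀ ε > 0, ∃ δ : E → ℝ, IsGauge (Set.Icc a b) δ ∧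
    ∀ P Q : Finset (E × E × E),
      IsHKPartition (Set.Icc a b) P → IsFine δ P →
      IsHKPartition (Set.Icc a b) Q → IsFine δ Q →
      ∑ x ∈ P, ∑ y ∈ Q, ‖f x.1 - f y.1‖ * (volume (itemBox x ∩ itemBox y)).toReal < ε

lemma exists_fine_subdivision_Icc {a b r : ℝ} (hab : a < b) (hr : 0 < r) :
    ∃ S : Finset (ℝ × ℝ),
      (∀ c ∈ S, a ≤ c.1 ∧ c.1 < c.2 ∧ c.2 ≤ b ∧ c.2 - c.1 < r) ∧
      (∀ c ∈ S, ∀ d ∈ S, c ≠ d → Ioo c.1 c.2 ∩ Ioo d.1 d.2 = ∅) ∧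
      ∀ y ∈ Icc a b, ∃ c ∈ S, y ∈ Icc c.1 c.2 := by
  classical
  obtain ⟨n, hn⟩ := exists_nat_gt ((b - a) / r)
  have hn0 : (0 : ℝ) < n := lt_of_le_of_lt (div_nonneg (sub_pos.2 hab).le hr.le) hn
  set h : ℝ := (b - a) / n with hh
  have hpos : 0 < h := div_pos (sub_pos.2 hab) hn0
  have hhr : h < r := by
    rw [hh, div_lt_iff₀ hn0]
    rw [div_lt_iff₀ hr] at hn
    linarith
  have hnh : n * h = b - a := by
    rw [hh]
    field_simp
  refine ⟨(Finset.range n).image fun i : ℕ => (a + i * h, a + (i + 1) * h), ?_, ?_, ?_⟩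
  · simp only [Finset.mem_image, Finset.mem_range]
    rintro _ ⟨i, hi, rfl⟩
    have hi' : (i : ℝ) + 1 ≤ n := by exact_mod_cast hi
    have h1 : ((i : ℝ) + 1) * h ≤ n * h := mul_le_mul_of_nonneg_right hi' hpos.le
    have h2 : 0 ≤ (i : ℝ) * h := by positivity
    exact ⟨by linarith, by linarith, by linarith, by linarith⟩
  · have key : ∀ i j : ℕ, i < j →
        Ioo (a + i * h) (a + (i + 1) * h) ∩ Ioo (a + j * h) (a + (j + 1) * h) = ∅ := by
      intro i j hij
      have hij' : (i : ℝ) + 1 ≤ j := by exact_mod_cast hij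
      have h1 : ((i : ℝ) + 1) * h ≤ j * h := mul_le_mul_of_nonneg_right hij' hpos.le
      ext y
      simp only [mem_inter_iff, mem_Ioo, mem_empty_iff_false, iff_false]
      rintro ⟨⟨-, h2⟩, h3, -⟩
      linarith
    simp only [Finset.mem_image, Finset.mem_range]
    rintro _ ⟨i, -, rfl⟩ _ ⟨j, -, rfl⟩ hne
    rcases lt_trichotomy i j with hij | rfl | hij
    · exact key i j hij
    · exact absurd rfl hne
    · rw [inter_comm]
      exact key j i hij
  · have key : ∀ m : ℕ, ∀ y ∈ Icc a (a + m * h), 0 < m →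
        ∃ i < m, y ∈ Icc (a + i * h) (a + (i + 1) * h) := by
      intro m
      induction m with
      | zero => intro y _ h0; exact absurd h0 (lt_irrefl 0)
      | succ m ih =>
        intro y hy _
        by_cases hym : a + m * h ≤ y
        · exact ⟨m, m.lt_succ_self, hym, by simpa using hy.2⟩
        · push Not at hym
          have hm : 0 < m := by
            rcases Nat.eq_zero_or_pos m with rfl | hm
            · simp only [Nat.cast_zero, zero_mul, add_zero] at hym
              exact absurd hy.1 hym.not_ge
            · exact hm
          obtain ⟨i, hi, hyi⟩ := ih y ⟨hy.1, hym.le⟩ hm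
          exact ⟨i, hi.trans m.lt_succ_self, hyi⟩
    intro y hy
    obtain ⟨i, hi, hyi⟩ := key n y ⟨hy.1, by linarith [hy.2]⟩ (by exact_mod_cast hn0)
    exact ⟨_, Finset.mem_image_of_mem _ (Finset.mem_range.2 hi), hyi⟩

lemma interior_Icc_real_prod (p q : ℝ × ℝ) :
    interior (Icc p q) = Ioo p.1 q.1 ×ˢ Ioo p.2 q.2 := by
  rw [Icc_prod_eq, interior_prod_eq, interior_Icc, interior_Icc]

lemma exists_fine_subdivision_Icc_prod {a b : ℝ × ℝ} {r : ℝ} (h₁ : a.1 < b.1) (h₂ : a.2 < b.2)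
    (hr : 0 < r) :
    ∃ S : Finset ((ℝ × ℝ) × (ℝ × ℝ)),
      (∀ c ∈ S, IsSubinterval (Icc a b) c.1 c.2) ∧
      (∀ c ∈ S, ∀ d ∈ S, c ≠ d → interior (Icc c.1 c.2) ∩ interior (Icc d.1 d.2) = ∅) ∧
      (⋃ c ∈ S, Icc c.1 c.2) = Icc a b ∧
      ∀ c ∈ S, ∀ z ∈ Icc c.1 c.2, Icc c.1 c.2 ⊆ Metric.ball z r := by
  classical
  obtain ⟨S, hS, hSd, hSc⟩ := exists_fine_subdivision_Icc h₁ hr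
  obtain ⟨T, hT, hTd, hTc⟩ := exists_fine_subdivision_Icc h₂ hr
  have hsub : ∀ s ∈ S, ∀ t ∈ T, Icc (s.1, t.1) (s.2, t.2) ⊆ Icc a b := by
    intro s hs t ht
    exact Icc_subset_Icc ⟨(hS s hs).1, (hT t ht).1⟩ ⟨(hS s hs).2.2.1, (hT t ht).2.2.1⟩
  refine ⟨(S ×ˢ T).image fun e => ((e.1.1, e.2.1), (e.1.2, e.2.2)), ?_, ?_, ?_, ?_⟩
  · simp only [Finset.mem_image, Finset.mem_product]
    rintro _ ⟨⟨s, t⟩, ⟨hs, ht⟩, rfl⟩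
    refine ⟨hsub s hs t ht, ?_⟩
    rw [interior_Icc_real_prod]
    exact (nonempty_Ioo.2 (hS s hs).2.1).prod (nonempty_Ioo.2 (hT t ht).2.1)
  · simp only [Finset.mem_image, Finset.mem_product]
    rintro _ ⟨⟨s, t⟩, ⟨hs, ht⟩, rfl⟩ _ ⟨⟨s', t'⟩, ⟨hs', ht'⟩, rfl⟩ hne
    rw [interior_Icc_real_prod, interior_Icc_real_prod, prod_inter_prod, prod_eq_empty_iff]
    by_cases hss : s = s'
    · refine Or.inr (hTd t ht t' ht' ?_)
      rintro rfl
      exact hne (by rw [hss])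
    · exact Or.inl (hSd s hs s' hs' hss)
  · apply Subset.antisymm
    · refine iUnion₂_subset ?_
      simp only [Finset.mem_image, Finset.mem_product]
      rintro _ ⟨⟨s, t⟩, ⟨hs, ht⟩, rfl⟩
      exact hsub s hs t ht
    · intro y hy
      obtain ⟨s, hs, hys⟩ := hSc y.1 ⟨hy.1.1, hy.2.1⟩
      obtain ⟨t, ht, hyt⟩ := hTc y.2 ⟨hy.1.2, hy.2.2⟩
      exact mem_iUnion₂.2 ⟨_, Finset.mem_image_of_mem _ (Finset.mk_mem_product hs ht),
        ⟨hys.1, hyt.1⟩, hys.2, hyt.2⟩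
  · simp only [Finset.mem_image, Finset.mem_product]
    rintro _ ⟨⟨s, t⟩, ⟨hs, ht⟩, rfl⟩ z ⟨⟨hz1, hz2⟩, hz3, hz4⟩ w ⟨⟨hw1, hw2⟩, hw3, hw4⟩
    have h1 := (hS s hs).2.2.2
    have h2 := (hT t ht).2.2.2
    simp only at hz1 hz2 hz3 hz4 hw1 hw2 hw3 hw4
    rw [Metric.mem_ball, Prod.dist_eq, Real.dist_eq, Real.dist_eq]
    exact max_lt (abs_lt.2 ⟨by linarith, by linarith⟩) (abs_lt.2 ⟨by linarith, by linarith⟩)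

lemma isCompact_volume_le_of_mcShane_sums_lt {a b : ℝ × ℝ} (h₁ : a.1 < b.1) (h₂ : a.2 < b.2)
    {Z : Set (ℝ × ℝ)} (hZ : Z ⊆ Icc a b) {δ : ℝ × ℝ → ℝ} (hδ : IsGauge (Icc a b) δ) {ε : ℝ}
    (hsum : ∀ P, IsMPartition (Icc a b) P → IsFine δ P →
      ∑ x ∈ P, (volume (itemBox x)).toReal • Z.indicator (fun _ => (1 : ℝ)) x.1 < ε)
    {C : Set (ℝ × ℝ)} (hC : IsCompact C) (hCK : C ⊆ Icc a b)
    (hCU : C ⊆ ⋃ t ∈ Z, Metric.ball t (δ t)) :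
    volume C ≤ ENNReal.ofReal ε := by
  classical
  obtain ⟨r₁, hr₁, hK⟩ := lebesgue_number_lemma_of_metric (c := fun t : Icc a b =>
    Metric.ball (t : ℝ × ℝ) (δ t)) isCompact_Icc (fun _ => Metric.isOpen_ball)
    fun t ht => mem_iUnion.2 ⟨⟨t, ht⟩, Metric.mem_ball_self (hδ t ht)⟩
  obtain ⟨r₂, hr₂, hCr⟩ := lebesgue_number_lemma_of_metric (c := fun t : Z =>
    Metric.ball (t : ℝ × ℝ) (δ t)) hC (fun _ => Metric.isOpen_ball)
    (by rwa [biUnion_eq_iUnion] at hCU)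
  obtain ⟨S, hSsub, hSd, hSU, hSr⟩ := exists_fine_subdivision_Icc_prod h₁ h₂ (lt_min hr₁ hr₂)
  have htag : ∀ c : (ℝ × ℝ) × (ℝ × ℝ), ∃ t : ℝ × ℝ, c ∈ S →
      t ∈ Icc a b ∧ Icc c.1 c.2 ⊆ Metric.ball t (δ t) ∧
      ((Icc c.1 c.2 ∩ C).Nonempty → t ∈ Z) := by
    intro c
    by_cases hc : c ∈ S
    · by_cases hne : (Icc c.1 c.2 ∩ C).Nonempty
      · obtain ⟨z, hz, hzC⟩ := hne
        obtain ⟨t, ht⟩ := hCr z hzC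
        exact ⟨t, fun _ => ⟨hZ t.2, (hSr c hc z hz).trans
          ((Metric.ball_subset_ball (min_le_right _ _)).trans ht), fun _ => t.2⟩⟩
      · obtain ⟨z, hz⟩ := (hSsub c hc).2
        have hz := interior_subset hz
        obtain ⟨t, ht⟩ := hK z ((hSsub c hc).1 hz)
        exact ⟨t, fun _ => ⟨t.2, (hSr c hc z hz).trans
          ((Metric.ball_subset_ball (min_le_left _ _)).trans ht), fun h => absurd h hne⟩⟩
    · exact ⟨0, fun h => absurd h hc⟩
  choose T hT using htag
  have hinj : ∀ c ∈ S, ∀ d ∈ S, (T c, c) = (T d, d) → c = d :=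
    fun c _ d _ h => congrArg Prod.snd h
  have hlt := hsum (S.image fun c => (T c, c)) ⟨?_, ?_, ?_⟩ ?_
  · rw [Finset.sum_image hinj] at hlt
    have hcover : C ⊆ ⋃ c ∈ S.filter fun c => (Icc c.1 c.2 ∩ C).Nonempty, Icc c.1 c.2 := by
      intro z hz
      have hzK := hCK hz
      rw [← hSU] at hzK
      obtain ⟨c, hc, hzc⟩ := mem_iUnion₂.1 hzK
      exact mem_iUnion₂.2 ⟨c, Finset.mem_filter.2 ⟨hc, z, hzc, hz⟩, hzc⟩
    calc volume C
        ≤ ∑ c ∈ S.filter fun c => (Icc c.1 c.2 ∩ C).Nonempty, volume (Icc c.1 c.2) :=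
          (measure_mono hcover).trans (measure_biUnion_finset_le _ _)
      _ = ENNReal.ofReal (∑ c ∈ S.filter fun c => (Icc c.1 c.2 ∩ C).Nonempty,
            (volume (Icc c.1 c.2)).toReal) := by
          rw [ENNReal.ofReal_sum_of_nonneg fun _ _ => ENNReal.toReal_nonneg]
          exact Finset.sum_congr rfl fun c _ =>
            (ENNReal.ofReal_toReal isCompact_Icc.measure_ne_top).symm
      _ ≤ ENNReal.ofReal ε := by
          refine ENNReal.ofReal_le_ofReal (le_trans ?_ hlt.le)
          rw [Finset.sum_filter]
          refine Finset.sum_le_sum fun c hc => ?_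
          split_ifs with hne
          · rw [indicator_of_mem ((hT c hc).2.2 hne), smul_eq_mul, mul_one]
            rfl
          · exact mul_nonneg ENNReal.toReal_nonneg (indicator_nonneg (fun _ _ => zero_le_one) _)
  · simp only [Finset.mem_image]
    rintro _ ⟨c, hc, rfl⟩
    exact ⟨(hT c hc).1, hSsub c hc⟩
  · simp only [Finset.mem_image]
    rintro _ ⟨c, hc, rfl⟩ _ ⟨d, hd, rfl⟩ hne
    exact hSd c hc d hd fun h => hne (by rw [h])
  · rw [Finset.set_biUnion_finset_image]
    exact hSU
  · simp only [IsFine, Finset.mem_image]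
    rintro _ ⟨c, hc, rfl⟩
    exact (hT c hc).2.1

lemma volume_eq_zero_of_hasMcShaneIntegral_indicator {a b : ℝ × ℝ} (h₁ : a.1 < b.1)
    (h₂ : a.2 < b.2) {Z : Set (ℝ × ℝ)} (hZ : Z ⊆ Icc a b)
    (h : HasMcShaneIntegral (Icc a b) (Z.indicator fun _ => (1 : ℝ)) 0) :
    volume Z = 0 := by
  refine nonpos_iff_eq_zero.1 (ENNReal.le_of_forall_pos_le_add fun ε hε _ => ?_)
  obtain ⟨δ, hδ, hP⟩ := h ε (NNReal.coe_pos.2 hε)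
  rw [zero_add]
  have hopen : IsOpen (⋃ t ∈ Z, Metric.ball t (δ t)) :=
    isOpen_biUnion fun _ _ => Metric.isOpen_ball
  calc volume Z ≤ volume (Icc a b ∩ ⋃ t ∈ Z, Metric.ball t (δ t)) :=
        measure_mono fun t ht =>
          ⟨hZ ht, mem_iUnion₂.2 ⟨t, ht, Metric.mem_ball_self (hδ t (hZ ht))⟩⟩
    _ ≤ ε := by
        rw [(measurableSet_Icc.inter hopen.measurableSet).measure_eq_iSup_isCompact]
        refine iSup₂_le fun C hC => iSup_le fun hCc => ?_
        rw [← ENNReal.ofReal_coe_nnreal]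
        refine isCompact_volume_le_of_mcShane_sums_lt h₁ h₂ hZ hδ (fun P hPM hPf => ?_) hCc
          (hC.trans inter_subset_left) (hC.trans inter_subset_right)
        have := hP P hPM hPf
        rw [sub_zero] at this
        exact (le_abs_self _).trans_lt this

lemma aedisjoint_Icc_of_interior_inter_eq_empty {p q r s : ℝ × ℝ}
    (h : interior (Icc p q) ∩ interior (Icc r s) = ∅) :
    AEDisjoint volume (Icc p q) (Icc r s) := by
  have hsub : Icc p q ∩ Icc r s ⊆ frontier (Icc p q) ∪ frontier (Icc r s) := by
    rintro x ⟨hx, hy⟩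
    by_cases hxi : x ∈ interior (Icc p q)
    · exact Or.inr ⟨subset_closure hy, fun hyi => eq_empty_iff_forall_notMem.1 h x ⟨hxi, hyi⟩⟩
    · exact Or.inl ⟨subset_closure hx, hxi⟩
  exact measure_mono_null hsub (measure_union_null ((convex_Icc p q).addHaar_frontier volume)
    ((convex_Icc r s).addHaar_frontier volume))

lemma hasStrongMcShaneIntegral_indicator_of_volume_eq_zero {X : Type*} [NormedAddCommGroup X]
    [NormedSpace ℝ X] {a b : ℝ × ℝ} {Z : Set (ℝ × ℝ)} (hZ : volume Z = 0) (f : ℝ × ℝ → X) :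
    HasStrongMcShaneIntegral a b (Z.indicator f) (0 : X) := by
  classical
  refine ⟨fun _ => 0, fun _ _ _ _ _ _ _ _ _ _ _ => (add_zero 0).symm, rfl, fun ε hε => ?_⟩
  obtain ⟨g, hg, hgl, hgi⟩ := exists_le_lowerSemicontinuous_lintegral_ge volume
    ((toMeasurable volume Z).indicator fun _ => (⊤ : ENNReal))
    (measurable_const.indicator (measurableSet_toMeasurable _ _))
    (ENNReal.ofReal_pos.2 (half_pos hε)).ne'
  rw [lintegral_indicator (measurableSet_toMeasurable _ _),
    setLIntegral_measure_zero _ _ ((measure_toMeasurable Z).trans hZ), zero_add] at hgi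
  have hball : ∀ t, ∃ δ > 0, t ∈ Z → ∀ y ∈ Metric.ball t δ, ‖f t‖ₑ < g y := by
    intro t
    by_cases ht : t ∈ Z
    · have hgt : ‖f t‖ₑ < g t := by
        refine enorm_lt_top.trans_le ((hg t).trans' ?_)
        rw [indicator_of_mem (subset_toMeasurable volume Z ht)]
      obtain ⟨δ, hδ, hδg⟩ := Metric.eventually_nhds_iff_ball.1 (hgl t _ hgt)
      exact ⟨δ, hδ, fun _ => hδg⟩
    · exact ⟨1, one_pos, fun h => absurd h ht⟩
  choose δ hδ hδg using hball
  refine ⟨δ, fun t _ => hδ t, fun P hP hPf => ?_⟩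
  have hle : ∀ x ∈ P, ENNReal.ofReal ‖(volume (itemBox x)).toReal • Z.indicator f x.1 - 0‖ ≤
      ∫⁻ y in itemBox x, g y := by
    intro x hx
    rw [sub_zero]
    by_cases ht : x.1 ∈ Z
    · rw [indicator_of_mem ht, norm_smul, Real.norm_of_nonneg ENNReal.toReal_nonneg,
        ENNReal.ofReal_mul ENNReal.toReal_nonneg, ofReal_norm,
        ENNReal.ofReal_toReal (show volume (itemBox x) ≠ ⊤ from isCompact_Icc.measure_ne_top),
        mul_comm, ← setLIntegral_const]
      exact setLIntegral_mono' measurableSet_Icc fun y hy => (hδg _ ht y (hPf x hx hy)).le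
    · simp [indicator_of_notMem ht]
  have hfin : ENNReal.ofReal (∑ x ∈ P,
      ‖(volume (itemBox x)).toReal • Z.indicator f x.1 - 0‖) ≤ ENNReal.ofReal (ε / 2) := by
    rw [ENNReal.ofReal_sum_of_nonneg fun _ _ => norm_nonneg _]
    refine (Finset.sum_le_sum hle).trans ?_
    rw [← lintegral_biUnion_finset₀ (t := itemBox) (fun x hx y hy hxy =>
        aedisjoint_Icc_of_interior_inter_eq_empty (hP.2.1 x hx y hy hxy))
      fun x _ => (measurableSet_Icc : MeasurableSet (itemBox x)).nullMeasurableSet]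
    exact (setLIntegral_le_lintegral _ _).trans hgi
  rw [ENNReal.ofReal_le_ofReal_iff (half_pos hε).le] at hfin
  linarith

/-- Lemma 2.1(ii): if `𝟙_Z` is integrable on `[a,b]` with integral `0`, then for any
`f : [a,b] → X` the function `f·𝟙_Z` is strongly integrable with integral `θ = 0`. -/
theorem strong_mcShane_integral_zero_of_indicator {X : Type*} [NormedAddCommGroup X] [NormedSpace ℝ X] [CompleteSpace X] (a₁ b₁ a₂ b₂ : ℝ) (hab₁ : a₁ < b₁) (hab₂ : a₂ < b₂)
    (Z : Set (ℝ × ℝ)) (hZ : Z ⊆ Set.Icc ((a₁, a₂) : ℝ × ℝ) (b₁, b₂))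
    (f : ℝ × ℝ → X)
    (hZ0 : HasMcShaneIntegral (Set.Icc ((a₁, a₂) : ℝ × ℝ) (b₁, b₂)) (Z.indicator (fun _ => (1 : ℝ))) 0) :
    HasStrongMcShaneIntegral ((a₁, a₂) : ℝ × ℝ) (b₁, b₂) (Z.indicator f) (0 : X) := by
  exact hasStrongMcShaneIntegral_indicator_of_volume_eq_zero
    (volume_eq_zero_of_hasMcShaneIntegral_indicator hab₁ hab₂ hZ hZ0) f
end

section
/- Let X be a real Banach space, Z ⊆ [a,b], and f : [a,b] → X any function. If the indicator function 𝟙_Z is Henstock–Kurzweil integrable on [a,b] with (HK)∫_{[a,b]} 𝟙_Z = 0, then f·𝟙_Z is strongly Henstock–Kurzweil integrable on [a,b] with (HK)∫_{[a,b]} f·𝟙_Z = θ, where θ is the zero vector of X. -/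
open Set MeasureTheory

variable {E : Type*} [MeasureSpace E] [PseudoMetricSpace E] [Preorder E]
variable {X : Type*} [NormedAddCommGroup X] [NormedSpace ℝ X]

open Topology
open scoped ENNReal NNReal

/-- A `δ`-fine `𝓗𝓚`-partition of `K` whose boxes tagged in `Z` cover the points `z ∈ Z ∩ K`
with `r < δ z` exists. -/
def HasCoveringPartition (δ : ℝ × ℝ → ℝ) (Z : Set (ℝ × ℝ)) (r : ℝ) (K : Set (ℝ × ℝ)) : Prop :=
  ∃ P : Finset ((ℝ × ℝ) × (ℝ × ℝ) × (ℝ × ℝ)), IsHKPartition K P ∧ IsFine δ P ∧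
    ∀ z ∈ Z ∩ K, r < δ z → ∃ x ∈ P, x.1 ∈ Z ∧ z ∈ itemBox x

theorem HasCoveringPartition.union {δ : ℝ × ℝ → ℝ} {Z : Set (ℝ × ℝ)} {r : ℝ}
    {K L : Set (ℝ × ℝ)} (hK : HasCoveringPartition δ Z r K) (hL : HasCoveringPartition δ Z r L)
    (hd : interior K ∩ interior L = ∅) : HasCoveringPartition δ Z r (K ∪ L) := by
  classical
  obtain ⟨P, ⟨⟨hP1, hP2, hP3⟩, hP4⟩, hPf, hPc⟩ := hK
  obtain ⟨Q, ⟨⟨hQ1, hQ2, hQ3⟩, hQ4⟩, hQf, hQc⟩ := hL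
  have key : ∀ x ∈ P, ∀ y ∈ Q, interior (itemBox x) ∩ interior (itemBox y) = ∅ := by
    intro x hx y hy
    refine subset_empty_iff.1 (hd ▸ inter_subset_inter ?_ ?_)
    · exact interior_mono (hP1 x hx).2.1
    · exact interior_mono (hQ1 y hy).2.1
  refine ⟨P ∪ Q, ⟨⟨?_, ?_, ?_⟩, ?_⟩, ?_, ?_⟩
  · intro x hx
    rcases Finset.mem_union.1 hx with h | h
    · exact ⟨.inl (hP1 x h).1, (hP1 x h).2.1.trans subset_union_left, (hP1 x h).2.2⟩
    · exact ⟨.inr (hQ1 x h).1, (hQ1 x h).2.1.trans subset_union_right, (hQ1 x h).2.2⟩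
  · intro x hx y hy hxy
    rcases Finset.mem_union.1 hx with h | h <;> rcases Finset.mem_union.1 hy with h' | h'
    · exact hP2 x h y h' hxy
    · exact key x h y h'
    · rw [inter_comm]
      exact key y h' x h
    · exact hQ2 x h y h' hxy
  · rw [Finset.set_biUnion_union, hP3, hQ3]
  · intro x hx
    rcases Finset.mem_union.1 hx with h | h
    · exact hP4 x h
    · exact hQ4 x h
  · intro x hx
    rcases Finset.mem_union.1 hx with h | h
    · exact hPf x h
    · exact hQf x h
  · rintro z ⟨hz, h | h⟩ hr
    · obtain ⟨x, hx, h'⟩ := hPc z ⟨hz, h⟩ hr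
      exact ⟨x, Finset.mem_union_left _ hx, h'⟩
    · obtain ⟨x, hx, h'⟩ := hQc z ⟨hz, h⟩ hr
      exact ⟨x, Finset.mem_union_right _ hx, h'⟩

theorem hasCoveringPartition_Icc_singleton {δ : ℝ × ℝ → ℝ} {Z : Set (ℝ × ℝ)} {r : ℝ}
    {p q t : ℝ × ℝ} (h₁ : p.1 < q.1) (h₂ : p.2 < q.2) (ht : t ∈ Icc p q)
    (hf : Icc p q ⊆ Metric.ball t (δ t)) (hZ : Z = ∅ ∨ t ∈ Z) :
    HasCoveringPartition δ Z r (Icc p q) := by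
  refine ⟨{(t, p, q)}, ⟨⟨?_, ?_, ?_⟩, ?_⟩, ?_, ?_⟩
  · simp only [Finset.mem_singleton, forall_eq]
    refine ⟨ht, subset_rfl, ?_⟩
    rw [Icc_prod_eq, interior_prod_eq, interior_Icc, interior_Icc]
    exact (nonempty_Ioo.2 h₁).prod (nonempty_Ioo.2 h₂)
  · simp
  · simp [itemBox]
  · simpa [itemBox] using ht
  · simpa [IsFine, itemBox] using hf
  · rintro z ⟨hz, hzK⟩ -
    rcases hZ with rfl | hZ
    · exact hz.elim
    · exact ⟨_, Finset.mem_singleton_self _, hZ, hzK⟩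

/-- Covering partitions of the four quarters of a rectangle combine to one of the rectangle. -/
theorem HasCoveringPartition.of_quarters {δ : ℝ × ℝ → ℝ} {Z : Set (ℝ × ℝ)} {r : ℝ}
    {p₁ p₂ q₁ q₂ : ℝ} (h₁ : p₁ < q₁) (h₂ : p₂ < q₂)
    (h : ∀ u₁ v₁ u₂ v₂ : ℝ, p₁ ≤ u₁ → v₁ ≤ q₁ → p₂ ≤ u₂ → v₂ ≤ q₂ →
      v₁ - u₁ = (q₁ - p₁) / 2 → v₂ - u₂ = (q₂ - p₂) / 2 →
      HasCoveringPartition δ Z r (Icc (u₁, u₂) (v₁, v₂))) :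
    HasCoveringPartition δ Z r (Icc (p₁, p₂) (q₁, q₂)) := by
  have hcol : ∀ u₁ v₁ : ℝ, p₁ ≤ u₁ → v₁ ≤ q₁ → v₁ - u₁ = (q₁ - p₁) / 2 →
      HasCoveringPartition δ Z r (Icc (u₁, p₂) (v₁, q₂)) := by
    intro u₁ v₁ hu hv huv
    have := (h u₁ v₁ p₂ ((p₂ + q₂) / 2) hu hv le_rfl (by linarith) huv (by ring)).union
      (h u₁ v₁ ((p₂ + q₂) / 2) q₂ hu hv (by linarith) le_rfl huv (by ring)) (by
        simp only [Icc_prod_eq, interior_prod_eq, interior_Icc]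
        ext ⟨x, y⟩
        simp only [mem_inter_iff, mem_prod, mem_Ioo, mem_empty_iff_false, iff_false]
        rintro ⟨⟨-, h3⟩, -, h4⟩
        linarith [h3.2, h4.1])
    rwa [Icc_prod_eq, Icc_prod_eq, ← prod_union,
      Icc_union_Icc_eq_Icc (by dsimp only; linarith) (by dsimp only; linarith),
      Icc_prod_Icc] at this
  have := (hcol p₁ ((p₁ + q₁) / 2) le_rfl (by linarith) (by ring)).union
    (hcol ((p₁ + q₁) / 2) q₁ (by linarith) le_rfl (by ring)) (by
      simp only [Icc_prod_eq, interior_prod_eq, interior_Icc]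
      ext ⟨x, y⟩
      simp only [mem_inter_iff, mem_prod, mem_Ioo, mem_empty_iff_false, iff_false]
      rintro ⟨⟨h3, -⟩, h4, -⟩
      linarith [h3.2, h4.1])
  rwa [Icc_prod_eq, Icc_prod_eq, ← union_prod,
    Icc_union_Icc_eq_Icc (by dsimp only; linarith) (by dsimp only; linarith),
    Icc_prod_Icc] at this

theorem Icc_subset_closedBall_of_mem {p q t : ℝ × ℝ} {r : ℝ} (h₁ : q.1 - p.1 ≤ r)
    (h₂ : q.2 - p.2 ≤ r) (ht : t ∈ Icc p q) : Icc p q ⊆ Metric.closedBall t r := by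
  intro x hx
  rw [Metric.mem_closedBall, Prod.dist_eq, Real.dist_eq, Real.dist_eq]
  refine max_le (abs_le.2 ⟨?_, ?_⟩) (abs_le.2 ⟨?_, ?_⟩) <;>
    linarith [hx.1.1, hx.1.2, hx.2.1, hx.2.2, ht.1.1, ht.1.2, ht.2.1, ht.2.2]

/-- Cousin's lemma for rectangles. -/
theorem hasCoveringPartition_empty {δ : ℝ × ℝ → ℝ} (hδ : ∀ t, 0 < δ t) (r : ℝ)
    {p q : ℝ × ℝ} (h₁ : p.1 < q.1) (h₂ : p.2 < q.2) :
    HasCoveringPartition δ ∅ r (Icc p q) := by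
  by_contra hbad
  let B := {x : (ℝ × ℝ) × (ℝ × ℝ) // x.1.1 < x.2.1 ∧ x.1.2 < x.2.2 ∧
    ¬ HasCoveringPartition δ ∅ r (Icc x.1 x.2)}
  have step : ∀ x : B, ∃ y : B, Icc y.1.1 y.1.2 ⊆ Icc x.1.1 x.1.2 ∧
      y.1.2.1 - y.1.1.1 = (x.1.2.1 - x.1.1.1) / 2 ∧
      y.1.2.2 - y.1.1.2 = (x.1.2.2 - x.1.1.2) / 2 := by
    rintro ⟨⟨⟨p₁, p₂⟩, ⟨q₁, q₂⟩⟩, h₁, h₂, hb⟩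
    dsimp only at h₁ h₂ hb
    by_contra! hcon
    refine hb (HasCoveringPartition.of_quarters h₁ h₂ fun u₁ v₁ u₂ v₂ a b c d e f => ?_)
    by_contra hb'
    exact hcon ⟨((u₁, u₂), (v₁, v₂)), by dsimp only; linarith, by dsimp only; linarith, hb'⟩
      (Icc_subset_Icc ⟨a, c⟩ ⟨b, d⟩) e f
  choose next hsub hw hh using step
  let s : ℕ → B := fun n => Nat.rec ⟨(p, q), h₁, h₂, hbad⟩ (fun _ x => next x) n
  have hs : ∀ n, s (n + 1) = next (s n) := fun n => rfl
  have hw' : ∀ n, (s n).1.2.1 - (s n).1.1.1 = (q.1 - p.1) / 2 ^ n := by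
    intro n
    induction n with
    | zero => simp [s]
    | succ n ih => rw [hs, hw, ih, pow_succ, div_div]
  have hh' : ∀ n, (s n).1.2.2 - (s n).1.1.2 = (q.2 - p.2) / 2 ^ n := by
    intro n
    induction n with
    | zero => simp [s]
    | succ n ih => rw [hs, hh, ih, pow_succ, div_div]
  obtain ⟨t, ht⟩ := IsCompact.nonempty_iInter_of_sequence_nonempty_isCompact_isClosed
    (fun n => Icc (s n).1.1 (s n).1.2) (fun n => by rw [hs]; exact hsub _)
    (fun n => nonempty_Icc.2 ⟨(s n).2.1.le, (s n).2.2.1.le⟩) isCompact_Icc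
    (fun n => isClosed_Icc)
  rw [mem_iInter] at ht
  have hlim : ∀ c : ℝ, ∀ᶠ n : ℕ in Filter.atTop, c / 2 ^ n ≤ δ t / 2 := by
    intro c
    have : Filter.Tendsto (fun n : ℕ => c / 2 ^ n) Filter.atTop (𝓝 0) :=
      tendsto_const_nhds.div_atTop (tendsto_pow_atTop_atTop_of_one_lt one_lt_two)
    exact this.eventually (eventually_le_nhds (half_pos (hδ t)))
  obtain ⟨n, hn₁, hn₂⟩ := ((hlim (q.1 - p.1)).and (hlim (q.2 - p.2))).exists
  refine (s n).2.2.2 (hasCoveringPartition_Icc_singleton (s n).2.1 (s n).2.2.1 (ht n) ?_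
    (.inl rfl))
  exact (Icc_subset_closedBall_of_mem (by rwa [hw']) (by rwa [hh']) (ht n)).trans
    (Metric.closedBall_subset_ball (half_lt_self (hδ t)))

theorem hasCoveringPartition_of_le {δ : ℝ × ℝ → ℝ} (hδ : ∀ t, 0 < δ t) (Z : Set (ℝ × ℝ)) (r : ℝ)
    (n : ℕ) {p₁ p₂ q₁ q₂ : ℝ} (h₁ : p₁ < q₁) (h₂ : p₂ < q₂)
    (hr₁ : q₁ - p₁ ≤ r * 2 ^ n) (hr₂ : q₂ - p₂ ≤ r * 2 ^ n) :
    HasCoveringPartition δ Z r (Icc (p₁, p₂) (q₁, q₂)) := by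
  induction n generalizing p₁ p₂ q₁ q₂ with
  | zero =>
    by_cases h : ∃ z ∈ Z ∩ Icc (p₁, p₂) (q₁, q₂), r < δ z
    · obtain ⟨z, ⟨hzZ, hz⟩, hr⟩ := h
      refine hasCoveringPartition_Icc_singleton h₁ h₂ hz ?_ (.inr hzZ)
      exact (Icc_subset_closedBall_of_mem (by simpa using hr₁) (by simpa using hr₂) hz).trans
        (Metric.closedBall_subset_ball hr)
    · obtain ⟨P, hP, hf, -⟩ := hasCoveringPartition_empty hδ r (p := (p₁, p₂)) (q := (q₁, q₂)) h₁ h₂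
      exact ⟨P, hP, hf, fun z hz hzr => absurd ⟨z, hz, hzr⟩ h⟩
  | succ n ih =>
    rw [pow_succ] at hr₁ hr₂
    exact HasCoveringPartition.of_quarters h₁ h₂ fun u₁ v₁ u₂ v₂ _ _ _ _ e f =>
      ih (by linarith) (by linarith) (by linarith) (by linarith)

theorem hasCoveringPartition_Icc {δ : ℝ × ℝ → ℝ} (hδ : ∀ t, 0 < δ t) (Z : Set (ℝ × ℝ)) {r : ℝ}
    (hr : 0 < r) {p₁ p₂ q₁ q₂ : ℝ} (h₁ : p₁ < q₁) (h₂ : p₂ < q₂) :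
    HasCoveringPartition δ Z r (Icc (p₁, p₂) (q₁, q₂)) := by
  obtain ⟨n, hn⟩ := pow_unbounded_of_one_lt (max (q₁ - p₁) (q₂ - p₂) / r) one_lt_two
  rw [div_lt_iff₀' hr] at hn
  exact hasCoveringPartition_of_le hδ Z r n h₁ h₂ ((le_max_left _ _).trans hn.le)
    ((le_max_right _ _).trans hn.le)

theorem volume_itemBox_ne_top (x : (ℝ × ℝ) × (ℝ × ℝ) × (ℝ × ℝ)) : volume (itemBox x) ≠ ∞ :=
  isCompact_Icc.measure_lt_top.ne

/-- A set whose indicator has Henstock–Kurzweil integral zero is Lebesgue null. -/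
theorem volume_eq_zero_of_hasHKIntegral_indicator {a₁ b₁ a₂ b₂ : ℝ} (hab₁ : a₁ < b₁)
    (hab₂ : a₂ < b₂) {Z : Set (ℝ × ℝ)} (hZ : Z ⊆ Icc (a₁, a₂) (b₁, b₂))
    (hZ0 : HasHKIntegral (Icc (a₁, a₂) (b₁, b₂)) (Z.indicator (fun _ => (1 : ℝ))) 0) :
    volume Z = 0 := by
  classical
  refine le_antisymm (ENNReal.le_of_forall_pos_le_add fun ε hε _ => ?_) zero_le
  rw [zero_add]
  obtain ⟨δ, hδ, hP⟩ := hZ0 ε (by exact_mod_cast hε)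
  set K : Set (ℝ × ℝ) := Icc (a₁, a₂) (b₁, b₂)
  let δ' : ℝ × ℝ → ℝ := fun t => if t ∈ K then δ t else 1
  have hδ' : ∀ t, 0 < δ' t := by
    intro t
    by_cases ht : t ∈ K
    · simpa [δ', ht] using hδ t ht
    · simp [δ', ht]
  have hbound : ∀ r : ℝ, 0 < r → volume {z ∈ Z | r < δ' z} ≤ ε := by
    intro r hr
    obtain ⟨P, hPK, hPf, hPc⟩ := hasCoveringPartition_Icc hδ' Z hr hab₁ hab₂
    have hfine : IsFine δ P := by
      intro x hx
      have := hPf x hx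
      rwa [show δ' x.1 = δ x.1 from if_pos (hPK.1.1 x hx).1] at this
    have hsum := hP P hPK hfine
    rw [sub_zero] at hsum
    have hsum' : ∑ x ∈ P with x.1 ∈ Z, (volume (itemBox x)).toReal ≤ ε := by
      refine le_trans (le_of_eq ?_) ((le_abs_self _).trans hsum.le)
      rw [Finset.sum_filter]
      refine Finset.sum_congr rfl fun x _ => ?_
      by_cases hx : x.1 ∈ Z <;> simp [hx]
    calc volume {z ∈ Z | r < δ' z}
        ≤ volume (⋃ x ∈ P.filter (·.1 ∈ Z), itemBox x) := by
          refine measure_mono ?_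
          rintro z ⟨hz, hzr⟩
          obtain ⟨x, hx, hxZ, hzx⟩ := hPc z ⟨hz, hZ hz⟩ hzr
          exact mem_biUnion (Finset.mem_filter.2 ⟨hx, hxZ⟩) hzx
      _ ≤ ∑ x ∈ P with x.1 ∈ Z, volume (itemBox x) := measure_biUnion_finset_le _ _
      _ = ENNReal.ofReal (∑ x ∈ P with x.1 ∈ Z, (volume (itemBox x)).toReal) := by
          rw [ENNReal.ofReal_sum_of_nonneg fun _ _ => ENNReal.toReal_nonneg]
          exact Finset.sum_congr rfl fun x _ =>
            (ENNReal.ofReal_toReal (volume_itemBox_ne_top x)).symm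
      _ ≤ ε := by
          rw [← ENNReal.ofReal_coe_nnreal]
          exact ENNReal.ofReal_le_ofReal hsum'
  have hmono : Monotone fun n : ℕ => {z ∈ Z | 1 / ((n : ℝ) + 1) < δ' z} := by
    intro m n hmn z hz
    exact ⟨hz.1, (Nat.one_div_le_one_div hmn).trans_lt hz.2⟩
  have hU : Z = ⋃ n : ℕ, {z ∈ Z | 1 / ((n : ℝ) + 1) < δ' z} := by
    ext z
    simp only [mem_iUnion, mem_ofPred_eq, exists_and_left]
    exact ⟨fun h => ⟨h, exists_nat_one_div_lt (hδ' z)⟩, fun h => h.1⟩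
  rw [hU, hmono.measure_iUnion]
  exact iSup_le fun n => hbound _ Nat.one_div_pos_of_nat

theorem aedisjoint_Icc_of_interior {p q u v : ℝ × ℝ}
    (h : interior (Icc p q) ∩ interior (Icc u v) = ∅) :
    AEDisjoint volume (Icc p q) (Icc u v) := by
  have hs : Icc p q ∩ Icc u v ⊆ frontier (Icc p q) ∪ frontier (Icc u v) := by
    rintro x ⟨hx, hy⟩
    by_contra hcon
    rw [mem_union, not_or] at hcon
    have h1 : x ∈ interior (Icc p q) := by
      by_contra h'
      exact hcon.1 ⟨subset_closure hx, h'⟩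
    have h2 : x ∈ interior (Icc u v) := by
      by_contra h'
      exact hcon.2 ⟨subset_closure hy, h'⟩
    exact (h ▸ (⟨h1, h2⟩ : x ∈ interior (Icc p q) ∩ interior (Icc u v)) : x ∈ (∅ : Set (ℝ × ℝ)))
  exact measure_mono_null hs (measure_union_null ((convex_Icc p q).addHaar_frontier volume)
    ((convex_Icc u v).addHaar_frontier volume))

/-- Lemma 2.1(ii): if `𝟙_Z` is integrable on `[a,b]` with integral `0`, then for any
`f : [a,b] → X` the function `f·𝟙_Z` is strongly integrable with integral `θ = 0`. -/
theorem strong_hk_integral_zero_of_indicator {X : Type*} [NormedAddCommGroup X] [NormedSpace ℝ X] [CompleteSpace X] (a₁ b₁ a₂ b₂ : ℝ) (hab₁ : a₁ < b₁) (hab₂ : a₂ < b₂)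
    (Z : Set (ℝ × ℝ)) (hZ : Z ⊆ Set.Icc ((a₁, a₂) : ℝ × ℝ) (b₁, b₂))
    (f : ℝ × ℝ → X)
    (hZ0 : HasHKIntegral (Set.Icc ((a₁, a₂) : ℝ × ℝ) (b₁, b₂)) (Z.indicator (fun _ => (1 : ℝ))) 0) :
    HasStrongHKIntegral ((a₁, a₂) : ℝ × ℝ) (b₁, b₂) (Z.indicator f) (0 : X) := by
  have hnull := volume_eq_zero_of_hasHKIntegral_indicator hab₁ hab₂ hZ hZ0
  refine ⟨fun _ => 0, fun _ _ _ _ _ _ _ _ _ _ _ => (add_zero _).symm, rfl, fun ε hε => ?_⟩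
  have hae : (fun t => ‖Z.indicator f t‖₊) =ᵐ[volume] fun _ => 0 := by
    filter_upwards [compl_mem_ae_iff.2 hnull] with t ht
    simp [indicator_of_notMem ht]
  obtain ⟨g, hfg, hg, hgi⟩ := exists_lt_lowerSemicontinuous_lintegral_ge_of_aemeasurable volume
    (fun t => ‖Z.indicator f t‖₊) (aemeasurable_const.congr hae.symm)
    (ε := ENNReal.ofReal (ε / 2)) (by simpa using hε)
  have hzero : ∫⁻ t, (‖Z.indicator f t‖₊ : ℝ≥0∞) = 0 := by
    refine (lintegral_congr_ae ?_).trans lintegral_zero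
    filter_upwards [hae] with t ht
    rw [ht, ENNReal.coe_zero]
  rw [hzero, zero_add] at hgi
  have hball : ∀ t, ∃ d > 0, ∀ y ∈ Metric.ball t d, (‖Z.indicator f t‖₊ : ℝ≥0∞) < g y :=
    fun t => Metric.eventually_nhds_iff_ball.1 (hg t _ (hfg t))
  choose δ hδ hδg using hball
  refine ⟨δ, fun t _ => hδ t, fun P hP hPf => ?_⟩
  have hsum : ∑ x ∈ P, ENNReal.ofReal ((volume (itemBox x)).toReal * ‖Z.indicator f x.1‖)
      ≤ ENNReal.ofReal (ε / 2) := by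
    calc ∑ x ∈ P, ENNReal.ofReal ((volume (itemBox x)).toReal * ‖Z.indicator f x.1‖)
        ≤ ∑ x ∈ P, ∫⁻ y in itemBox x, g y := by
          refine Finset.sum_le_sum fun x hx => ?_
          rw [ENNReal.ofReal_mul ENNReal.toReal_nonneg,
            ENNReal.ofReal_toReal (volume_itemBox_ne_top x), mul_comm, ofReal_norm,
            ← setLIntegral_const]
          exact setLIntegral_mono' measurableSet_Icc fun y hy => (hδg x.1 y (hPf x hx hy)).le
      _ = ∫⁻ y in ⋃ x ∈ P, itemBox x, g y := by
          refine (lintegral_biUnion_finset₀ ?_ (fun x _ => measurableSet_Icc.nullMeasurableSet)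
            g).symm
          intro x hx y hy hxy
          exact aedisjoint_Icc_of_interior (hP.1.2.1 x hx y hy hxy)
      _ ≤ ∫⁻ y, g y := setLIntegral_le_lintegral _ _
      _ ≤ ENNReal.ofReal (ε / 2) := hgi
  rw [← ENNReal.ofReal_sum_of_nonneg fun _ _ => by positivity,
    ENNReal.ofReal_le_ofReal_iff (by positivity)] at hsum
  refine lt_of_le_of_lt (le_of_eq_of_le (Finset.sum_congr rfl fun x _ => ?_) hsum)
    (half_lt_self hε)
  rw [sub_zero, norm_smul, Real.norm_of_nonneg ENNReal.toReal_nonneg]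
end

section
/- Let f : [a,b] → X be strongly McShane integrable on [a,b] and assume that for every t₁ ∈ [a₁,b₁] the section f_{t₁} is strongly McShane integrable on [a₂,b₂] and for every t₂ ∈ [a₂,b₂] the section f_{t₂} is strongly McShane integrable on [a₁,b₁]. Then the function g(t₁) = (M)∫_{[a₂,b₂]} f_{t₁}, t₁ ∈ [a₁,b₁], is strongly McShane integrable on [a₁,b₁] and (M)∫_{[a₁,b₁]} ((M)∫_{[a₂,b₂]} f_{t₁}) = (M)∫_{[a,b]} f. -/
open Set MeasureTheory

variable {E : Type*} [MeasureSpace E] [PseudoMetricSpace E] [Preorder E]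
variable {X : Type*} [NormedAddCommGroup X] [NormedSpace ℝ X]

theorem isSubinterval_Icc_iff {a b p q : ℝ} :
    IsSubinterval (Icc a b) p q ↔ p < q ∧ a ≤ p ∧ q ≤ b := by
  unfold IsSubinterval
  rw [interior_Icc, nonempty_Ioo]
  constructor
  · rintro ⟨h, hpq⟩
    exact ⟨hpq, (Icc_subset_Icc_iff hpq.le).1 h⟩
  · rintro ⟨hpq, h⟩
    exact ⟨(Icc_subset_Icc_iff hpq.le).2 h, hpq⟩

theorem Icc_mk_mk (p q r s : ℝ) : Icc (p, r) (q, s) = Icc p q ×ˢ Icc r s :=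
  (Icc_prod_Icc p q r s).symm

theorem IsSubinterval.prod {A B : Set ℝ} {p q r s : ℝ} (h : IsSubinterval A p q)
    (h' : IsSubinterval B r s) : IsSubinterval (A ×ˢ B) (p, r) (q, s) := by
  refine ⟨?_, ?_⟩
  · rw [Icc_mk_mk]
    exact prod_mono h.1 h'.1
  · rw [Icc_mk_mk, interior_prod_eq]
    exact h.2.prod h'.2

/-- Cousin's lemma, as an induction principle on intervals. -/
theorem cousin_induction {a b : ℝ} (hab : a < b) {δ : ℝ → ℝ} (hδ : IsGauge (Icc a b) δ)
    (C : ℝ → ℝ → Prop)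
    (single : ∀ t ∈ Icc a b, ∀ p q, a ≤ p → p < q → q ≤ b →
      Icc p q ⊆ Metric.ball t (δ t) → C p q)
    (merge : ∀ p q r, a ≤ p → p < q → q < r → r ≤ b → C p q → C q r → C p r) :
    C a b := by
  set S : Set ℝ := {x | x ∈ Icc a b ∧ (x = a ∨ C a x)} with hS
  have haS : a ∈ S := ⟨left_mem_Icc.2 hab.le, Or.inl rfl⟩
  have hbdd : BddAbove S := ⟨b, fun x hx => hx.1.2⟩
  set c := sSup S with hc
  have hcI : c ∈ Icc a b := ⟨le_csSup hbdd haS, csSup_le ⟨a, haS⟩ fun x hx => hx.1.2⟩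
  have hδc := hδ c hcI
  obtain ⟨x, hxS, hx⟩ := exists_lt_of_lt_csSup ⟨a, haS⟩ (show c - δ c < sSup S by linarith)
  have hxc : x ≤ c := le_csSup hbdd hxS
  have key : ∀ y, x < y → y ≤ b → y < c + δ c → y ∈ S := by
    intro y hxy hyb hyc
    have hC : C x y := single c hcI x y hxS.1.1 hxy hyb fun z hz => by
      rw [Metric.mem_ball, Real.dist_eq, abs_lt]
      constructor <;> linarith [hz.1, hz.2]
    refine ⟨⟨hxS.1.1.trans hxy.le, hyb⟩, Or.inr ?_⟩
    rcases hxS.2 with rfl | h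
    · exact hC
    · rcases hxS.1.1.eq_or_lt with rfl | hax
      · exact hC
      · exact merge a x y le_rfl hax hxy hyb h hC
  have hbS : b ∈ S := by
    rcases hcI.2.eq_or_lt with hcb | hcb
    · rcases hxc.eq_or_lt with hxc | hxc
      · rwa [← hcb, ← hxc]
      · exact key b (by linarith) le_rfl (by linarith)
    · have hlt : c < min b (c + δ c / 2) := lt_min hcb (by linarith)
      have hmem := key (min b (c + δ c / 2)) (hxc.trans_lt hlt) (min_le_left _ _)
        ((min_le_right _ _).trans_lt (by linarith))
      exact absurd (le_csSup hbdd hmem) (not_le.2 hlt)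
  rcases hbS.2 with h | h
  · exact absurd h hab.ne'
  · exact h

/-- Every gauge on a compact interval admits a fine partition, which can be chosen such that all
additive interval functions are additive along it. -/
theorem exists_isFine_isMPartition (X : Type*) [NormedAddCommGroup X] {a b : ℝ} (hab : a < b)
    {δ : ℝ → ℝ} (hδ : IsGauge (Icc a b) δ) :
    ∃ P : Finset (ℝ × ℝ × ℝ), IsMPartition (Icc a b) P ∧ IsFine δ P ∧
      ∀ F : ℝ × ℝ → X, IsAdditiveIntervalFun (Icc a b) F →
        F (a, b) = ∑ x ∈ P, F (x.2.1, x.2.2) := by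
  have main := cousin_induction hab hδ (fun p q => ∃ P : Finset (ℝ × ℝ × ℝ),
    ((∀ x ∈ P, x.1 ∈ Icc a b ∧ IsSubinterval (Icc p q) x.2.1 x.2.2) ∧
      (∀ x ∈ P, ∀ y ∈ P, x ≠ y → interior (itemBox x) ∩ interior (itemBox y) = ∅) ∧
      (⋃ x ∈ P, itemBox x) = Icc p q) ∧ IsFine δ P ∧
      ∀ F : ℝ × ℝ → X, IsAdditiveIntervalFun (Icc a b) F →
        F (p, q) = ∑ x ∈ P, F (x.2.1, x.2.2)) ?_ ?_
  · exact main
  · intro t ht p q _ hpq _ hball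
    refine ⟨{(t, p, q)}, ⟨?_, ?_, ?_⟩, ?_, ?_⟩
    · simpa [isSubinterval_Icc_iff, hpq] using ht
    · simp
    · simp [itemBox]
    · simpa [IsFine, itemBox] using hball
    · simp
  · rintro p q r hap hpq hqr hrb ⟨P, ⟨hP₁, hP₂, hP₃⟩, hPf, hPF⟩ ⟨Q, ⟨hQ₁, hQ₂, hQ₃⟩, hQf, hQF⟩
    have hPQ : ∀ x ∈ P, ∀ y ∈ Q, interior (itemBox x) ∩ interior (itemBox y) = ∅ := by
      intro x hx y hy
      have h₁ := (isSubinterval_Icc_iff.1 (hP₁ x hx).2).2.2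
      have h₂ := (isSubinterval_Icc_iff.1 (hQ₁ y hy).2).2.1
      simp only [itemBox, interior_Icc]
      ext z
      simp only [mem_inter_iff, mem_Ioo, mem_empty_iff_false, iff_false]
      rintro ⟨⟨_, h₃⟩, h₄, _⟩
      linarith
    have hdisj : Disjoint P Q := by
      rw [Finset.disjoint_left]
      intro x hx hx'
      have h := hPQ x hx x hx'
      rw [inter_self] at h
      exact (hP₁ x hx).2.2.ne_empty h
    classical
    refine ⟨P ∪ Q, ⟨?_, ?_, ?_⟩, ?_, ?_⟩
    · intro x hx
      rcases Finset.mem_union.1 hx with hx | hx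
      · exact ⟨(hP₁ x hx).1, (hP₁ x hx).2.1.trans (Icc_subset_Icc_right hqr.le), (hP₁ x hx).2.2⟩
      · exact ⟨(hQ₁ x hx).1, (hQ₁ x hx).2.1.trans (Icc_subset_Icc_left hpq.le), (hQ₁ x hx).2.2⟩
    · intro x hx y hy hxy
      rcases Finset.mem_union.1 hx with hx | hx <;> rcases Finset.mem_union.1 hy with hy | hy
      · exact hP₂ x hx y hy hxy
      · exact hPQ x hx y hy
      · rw [inter_comm]
        exact hPQ y hy x hx
      · exact hQ₂ x hx y hy hxy
    · rw [Finset.set_biUnion_union, hP₃, hQ₃, Icc_union_Icc_eq_Icc hpq.le hqr.le]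
    · intro x hx
      rcases Finset.mem_union.1 hx with hx | hx
      · exact hPf x hx
      · exact hQf x hx
    · intro F hF
      rw [Finset.sum_union hdisj, ← hPF F hF, ← hQF F hF]
      refine hF p q q r p r (isSubinterval_Icc_iff.2 ⟨hpq, hap, hqr.le.trans hrb⟩)
        (isSubinterval_Icc_iff.2 ⟨hqr, hap.trans hpq.le, hrb⟩)
        (isSubinterval_Icc_iff.2 ⟨hpq.trans hqr, hap, hrb⟩) ?_
        (Icc_union_Icc_eq_Icc hpq.le hqr.le)
      simp only [interior_Icc]
      ext z
      simp only [mem_inter_iff, mem_Ioo, mem_empty_iff_false, iff_false]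
      rintro ⟨⟨_, h₃⟩, h₄, _⟩
      linarith

theorem IsMPartition.sum_volume_le {a b : ℝ} (hab : a ≤ b) {P : Finset (ℝ × ℝ × ℝ)}
    (hP : IsMPartition (Icc a b) P) :
    ∑ x ∈ P, (volume (itemBox x)).toReal ≤ b - a := by
  have hvol : ∀ x ∈ P, (volume (itemBox x)).toReal = volume.real (interior (itemBox x)) := by
    intro x _
    simp [itemBox, Measure.real]
  rw [Finset.sum_congr rfl hvol, ← measureReal_biUnion_finset
    (fun x hx y hy hxy => disjoint_iff_inter_eq_empty.2 (hP.2.1 x hx y hy hxy))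
    (fun x _ => isOpen_interior.measurableSet)
    (fun x _ => by simp [itemBox])]
  calc volume.real (⋃ x ∈ P, interior (itemBox x))
      ≤ volume.real (Icc a b) := measureReal_mono
        (iUnion₂_subset fun x hx => interior_subset.trans (hP.1 x hx).2.1) (by simp)
    _ = b - a := Real.volume_real_Icc_of_le hab

/-- The product of a tagged interval of the first axis and one of the second axis. -/
def prodItem (x y : ℝ × ℝ × ℝ) : (ℝ × ℝ) × (ℝ × ℝ) × (ℝ × ℝ) :=
  ((x.1, y.1), (x.2.1, y.2.1), (x.2.2, y.2.2))

theorem itemBox_prodItem (x y : ℝ × ℝ × ℝ) :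
    itemBox (prodItem x y) = itemBox x ×ˢ itemBox y :=
  Icc_mk_mk _ _ _ _

theorem volume_itemBox_prodItem (x y : ℝ × ℝ × ℝ) :
    (volume (itemBox (prodItem x y))).toReal =
      (volume (itemBox x)).toReal * (volume (itemBox y)).toReal := by
  rw [itemBox_prodItem, Measure.volume_eq_prod, Measure.prod_prod, ENNReal.toReal_mul]

/-- The embedding underlying the product of a partition with a family of partitions. -/
def prodItemEmbedding : (Σ _ : ℝ × ℝ × ℝ, ℝ × ℝ × ℝ) ↪ (ℝ × ℝ) × (ℝ × ℝ) × (ℝ × ℝ) where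
  toFun z := prodItem z.1 z.2
  inj' := by
    rintro ⟨⟨t, p, q⟩, s, r, u⟩ ⟨⟨t', p', q'⟩, s', r', u'⟩ h
    simp only [prodItem, Prod.mk.injEq] at h
    obtain ⟨⟨rfl, rfl⟩, ⟨rfl, rfl⟩, rfl, rfl⟩ := h
    rfl

/-- The partition of a rectangle obtained by cutting the strip over each `x ∈ P` along `D x`. -/
def stripPartition (P : Finset (ℝ × ℝ × ℝ)) (D : ℝ × ℝ × ℝ → Finset (ℝ × ℝ × ℝ)) :
    Finset ((ℝ × ℝ) × (ℝ × ℝ) × (ℝ × ℝ)) :=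
  (P.sigma D).map prodItemEmbedding

theorem mem_stripPartition {P : Finset (ℝ × ℝ × ℝ)} {D : ℝ × ℝ × ℝ → Finset (ℝ × ℝ × ℝ)}
    {z : (ℝ × ℝ) × (ℝ × ℝ) × (ℝ × ℝ)} :
    z ∈ stripPartition P D ↔ ∃ x ∈ P, ∃ y ∈ D x, prodItem x y = z := by
  simp only [stripPartition, Finset.mem_map, Finset.mem_sigma, prodItemEmbedding]
  constructor
  · rintro ⟨⟨x, y⟩, ⟨hx, hy⟩, h⟩
    exact ⟨x, hx, y, hy, h⟩
  · rintro ⟨x, hx, y, hy, h⟩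
    exact ⟨⟨x, y⟩, ⟨hx, hy⟩, h⟩

theorem sum_stripPartition {M : Type*} [AddCommMonoid M] (P : Finset (ℝ × ℝ × ℝ))
    (D : ℝ × ℝ × ℝ → Finset (ℝ × ℝ × ℝ)) (φ : (ℝ × ℝ) × (ℝ × ℝ) × (ℝ × ℝ) → M) :
    ∑ z ∈ stripPartition P D, φ z = ∑ x ∈ P, ∑ y ∈ D x, φ (prodItem x y) := by
  rw [stripPartition, Finset.sum_map, Finset.sum_sigma]
  rfl

theorem IsMPartition.stripPartition {A B : Set ℝ} {P : Finset (ℝ × ℝ × ℝ)}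
    {D : ℝ × ℝ × ℝ → Finset (ℝ × ℝ × ℝ)} (hP : IsMPartition A P)
    (hD : ∀ x ∈ P, IsMPartition B (D x)) : IsMPartition (A ×ˢ B) (stripPartition P D) := by
  refine ⟨?_, ?_, ?_⟩
  · intro z hz
    obtain ⟨x, hx, y, hy, rfl⟩ := mem_stripPartition.1 hz
    exact ⟨⟨(hP.1 x hx).1, ((hD x hx).1 y hy).1⟩, (hP.1 x hx).2.prod ((hD x hx).1 y hy).2⟩
  · intro z hz z' hz' hne
    obtain ⟨x, hx, y, hy, rfl⟩ := mem_stripPartition.1 hz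
    obtain ⟨x', hx', y', hy', rfl⟩ := mem_stripPartition.1 hz'
    rw [itemBox_prodItem, itemBox_prodItem, interior_prod_eq, interior_prod_eq, prod_inter_prod,
      prod_eq_empty_iff]
    by_cases hxx : x = x'
    · subst hxx
      refine Or.inr ((hD x hx).2.1 y hy y' hy' ?_)
      rintro rfl
      exact hne rfl
    · exact Or.inl (hP.2.1 x hx x' hx' hxx)
  · ext ⟨t, s⟩
    simp only [mem_iUnion, mem_prod]
    constructor
    · rintro ⟨z, hz, hmem⟩
      obtain ⟨x, hx, y, hy, rfl⟩ := mem_stripPartition.1 hz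
      rw [itemBox_prodItem] at hmem
      exact ⟨(hP.1 x hx).2.1 hmem.1, ((hD x hx).1 y hy).2.1 hmem.2⟩
    · rintro ⟨ht, hs⟩
      rw [← hP.2.2] at ht
      simp only [mem_iUnion] at ht
      obtain ⟨x, hx, htx⟩ := ht
      rw [← (hD x hx).2.2] at hs
      simp only [mem_iUnion] at hs
      obtain ⟨y, hy, hsy⟩ := hs
      refine ⟨prodItem x y, mem_stripPartition.2 ⟨x, hx, y, hy, rfl⟩, ?_⟩
      rw [itemBox_prodItem]
      exact ⟨htx, hsy⟩

section

variable {Y : Type*} [NormedAddCommGroup Y]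

theorem IsAdditiveIntervalFun.fst {a₁ b₁ a₂ b₂ : ℝ} (hab₂ : a₂ < b₂) {F : (ℝ × ℝ) × (ℝ × ℝ) → Y}
    (hF : IsAdditiveIntervalFun (Icc (a₁, a₂) (b₁, b₂)) F) :
    IsAdditiveIntervalFun (Icc a₁ b₁) (fun I : ℝ × ℝ => F ((I.1, a₂), (I.2, b₂))) := by
  intro p q r s u w hpq hrs huw hdisj hunion
  have hJ : IsSubinterval (Icc a₂ b₂) a₂ b₂ := isSubinterval_Icc_iff.2 ⟨hab₂, le_rfl, le_rfl⟩
  rw [Icc_mk_mk] at hF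
  refine hF _ _ _ _ _ _ (hpq.prod hJ) (hrs.prod hJ) (huw.prod hJ) ?_ ?_
  · rw [Icc_mk_mk, Icc_mk_mk, interior_prod_eq, interior_prod_eq, prod_inter_prod, hdisj,
      empty_prod]
  · rw [Icc_mk_mk, Icc_mk_mk, Icc_mk_mk, ← union_prod, hunion]

theorem IsAdditiveIntervalFun.snd {a₁ b₁ a₂ b₂ p₁ q₁ : ℝ} (hI : IsSubinterval (Icc a₁ b₁) p₁ q₁)
    {F : (ℝ × ℝ) × (ℝ × ℝ) → Y}
    (hF : IsAdditiveIntervalFun (Icc (a₁, a₂) (b₁, b₂)) F) :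
    IsAdditiveIntervalFun (Icc a₂ b₂) (fun J : ℝ × ℝ => F ((p₁, J.1), (q₁, J.2))) := by
  intro p q r s u w hpq hrs huw hdisj hunion
  rw [Icc_mk_mk] at hF
  refine hF _ _ _ _ _ _ (hI.prod hpq) (hI.prod hrs) (hI.prod huw) ?_ ?_
  · rw [Icc_mk_mk, Icc_mk_mk, interior_prod_eq, interior_prod_eq, prod_inter_prod, hdisj,
      prod_empty]
  · rw [Icc_mk_mk, Icc_mk_mk, Icc_mk_mk, ← prod_union, hunion]

theorem exists_pos_forall_le {ι : Type*} (P : Finset ι) (c : ι → ℝ) (hc : ∀ y ∈ P, 0 < c y) :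
    ∃ η > 0, ∀ y ∈ P, η ≤ c y := by
  have h : ∀ᶠ η in nhdsWithin (0 : ℝ) (Ioi 0), ∀ y ∈ P, η ≤ c y := by
    rw [Filter.eventually_all_finset]
    intro y hy
    filter_upwards [Ioc_mem_nhdsGT (hc y hy)] with η hη using hη.2
  obtain ⟨η, hη, hpos⟩ := (h.and self_mem_nhdsWithin).exists
  exact ⟨η, hpos, hη⟩

variable [NormedSpace ℝ Y]

/-- A strongly McShane integrable function has, for every gauge, a fine partition whose McShane sum
is close to the integral. -/
theorem HasStrongMcShaneIntegral.exists_isFine_approx {a b : ℝ} (hab : a < b) {h : ℝ → Y} {u : Y}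
    (hh : HasStrongMcShaneIntegral a b h u) {δ : ℝ → ℝ} (hδ : IsGauge (Icc a b) δ)
    {ε : ℝ} (hε : 0 < ε) :
    ∃ P : Finset (ℝ × ℝ × ℝ), IsMPartition (Icc a b) P ∧ IsFine δ P ∧
      (∀ F : ℝ × ℝ → Y, IsAdditiveIntervalFun (Icc a b) F →
        F (a, b) = ∑ x ∈ P, F (x.2.1, x.2.2)) ∧
      ‖u - ∑ x ∈ P, (volume (itemBox x)).toReal • h x.1‖ ≤ ε := by
  obtain ⟨H, hH, rfl, hHε⟩ := hh
  obtain ⟨η, hη, hηP⟩ := hHε ε hε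
  obtain ⟨P, hP, hPf, hPF⟩ := exists_isFine_isMPartition Y hab (δ := fun s => min (η s) (δ s))
    fun s hs => lt_min (hη s hs) (hδ s hs)
  refine ⟨P, hP, fun x hx => (hPf x hx).trans (Metric.ball_subset_ball (min_le_right _ _)), hPF, ?_⟩
  have hsum := hηP P hP fun x hx => (hPf x hx).trans (Metric.ball_subset_ball (min_le_left _ _))
  rw [hPF H hH, norm_sub_rev, ← Finset.sum_sub_distrib]
  exact (norm_sum_le _ _).trans hsum.le

end

/-- Lemma 2.2(i) for the McShane integral:
if `f` is strongly integrable on `[a,b]` with integral `v` and all sections are strongly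
integrable, then the iterated integral of the sections is strongly integrable with integral `v`. -/
theorem fubini_strong_mcShane_fst {X : Type*} [NormedAddCommGroup X] [NormedSpace ℝ X] [CompleteSpace X] (a₁ b₁ a₂ b₂ : ℝ) (hab₁ : a₁ < b₁) (hab₂ : a₂ < b₂)
    (f : ℝ × ℝ → X) (v : X) (g : ℝ → X)
    (hf : HasStrongMcShaneIntegral ((a₁, a₂) : ℝ × ℝ) (b₁, b₂) f v)
    (hg : ∀ t₁ ∈ Set.Icc a₁ b₁, HasStrongMcShaneIntegral a₂ b₂ (fun s₂ => f (t₁, s₂)) (g t₁))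
    (hsec : ∀ t₂ ∈ Set.Icc a₂ b₂, ∃ u : X, HasStrongMcShaneIntegral a₁ b₁ (fun s₁ => f (s₁, t₂)) u) :
    HasStrongMcShaneIntegral a₁ b₁ g v := by
  obtain ⟨F, hF, rfl, hFε⟩ := hf
  refine ⟨fun I => F ((I.1, a₂), (I.2, b₂)), hF.fst hab₂, rfl, fun ε hε => ?_⟩
  obtain ⟨δ, hδ, hδP⟩ := hFε (ε / 2) (half_pos hε)
  rw [Icc_mk_mk] at hδ hδP
  have hℓ : 0 < b₁ - a₁ := sub_pos.2 hab₁
  have hε' : 0 < ε / 2 / (b₁ - a₁) := div_pos (half_pos hε) hℓ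
  have hD : ∀ t ∈ Icc a₁ b₁, ∃ (η : ℝ) (D : Finset (ℝ × ℝ × ℝ)), 0 < η ∧
      (∀ y ∈ D, η ≤ δ (t, y.1)) ∧ IsMPartition (Icc a₂ b₂) D ∧
      IsFine (fun s => δ (t, s)) D ∧
      (∀ H : ℝ × ℝ → X, IsAdditiveIntervalFun (Icc a₂ b₂) H →
        H (a₂, b₂) = ∑ y ∈ D, H (y.2.1, y.2.2)) ∧
      ‖g t - ∑ y ∈ D, (volume (itemBox y)).toReal • f (t, y.1)‖ ≤ ε / 2 / (b₁ - a₁) := by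
    intro t ht
    have hδt : IsGauge (Icc a₂ b₂) fun s => δ (t, s) := fun s hs => hδ (t, s) ⟨ht, hs⟩
    obtain ⟨D, hD, hDf, hDF, hDε⟩ := (hg t ht).exists_isFine_approx hab₂ hδt hε'
    obtain ⟨η, hη, hηD⟩ := exists_pos_forall_le D (fun y => δ (t, y.1))
      fun y hy => hδt y.1 (hD.1 y hy).1
    exact ⟨η, D, hη, hηD, hD, hDf, hDF, hDε⟩
  choose! η D hη hηD hDP hDf hDF hDε using hD
  refine ⟨η, hη, fun P hP hPf => ?_⟩
  have htag : ∀ x ∈ P, x.1 ∈ Icc a₁ b₁ := fun x hx => (hP.1 x hx).1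
  have hstrip := hδP (stripPartition P fun x => D x.1)
    (hP.stripPartition fun x hx => hDP x.1 (htag x hx)) (by
      intro z hz
      obtain ⟨x, hx, y, hy, rfl⟩ := mem_stripPartition.1 hz
      rw [itemBox_prodItem]
      change _ ⊆ Metric.ball (x.1, y.1) (δ (x.1, y.1))
      rw [← ball_prod_same]
      exact prod_mono
        ((hPf x hx).trans (Metric.ball_subset_ball (hηD x.1 (htag x hx) y hy)))
        (hDf x.1 (htag x hx) y hy))
  rw [sum_stripPartition] at hstrip
  simp only [volume_itemBox_prodItem] at hstrip
  have hterm : ∀ x ∈ P,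
      ‖(volume (itemBox x)).toReal • g x.1 - F ((x.2.1, a₂), (x.2.2, b₂))‖ ≤
        (volume (itemBox x)).toReal * (ε / 2 / (b₁ - a₁)) +
        ∑ y ∈ D x.1, ‖((volume (itemBox x)).toReal * (volume (itemBox y)).toReal) •
          f (prodItem x y).1 - F ((prodItem x y).2.1, (prodItem x y).2.2)‖ := by
    intro x hx
    have hFx := hDF x.1 (htag x hx) _ (hF.snd (hP.1 x hx).2)
    have hsplit : (volume (itemBox x)).toReal • g x.1 - F ((x.2.1, a₂), (x.2.2, b₂)) =
        (volume (itemBox x)).toReal •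
          (g x.1 - ∑ y ∈ D x.1, (volume (itemBox y)).toReal • f (x.1, y.1)) +
        ∑ y ∈ D x.1, (((volume (itemBox x)).toReal * (volume (itemBox y)).toReal) •
          f (prodItem x y).1 - F ((prodItem x y).2.1, (prodItem x y).2.2)) := by
      rw [hFx, Finset.sum_sub_distrib, smul_sub, Finset.smul_sum]
      simp only [smul_smul, prodItem]
      abel
    rw [hsplit]
    refine (norm_add_le _ _).trans (add_le_add ?_ (norm_sum_le _ _))
    rw [norm_smul, Real.norm_of_nonneg ENNReal.toReal_nonneg]
    exact mul_le_mul_of_nonneg_left (hDε x.1 (htag x hx)) ENNReal.toReal_nonneg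
  calc ∑ x ∈ P, ‖(volume (itemBox x)).toReal • g x.1 - F ((x.2.1, a₂), (x.2.2, b₂))‖
      ≤ _ := Finset.sum_le_sum hterm
    _ < ε / 2 + ε / 2 := by
      rw [Finset.sum_add_distrib, ← Finset.sum_mul]
      refine add_lt_add_of_le_of_lt ?_ hstrip
      calc _ ≤ (b₁ - a₁) * (ε / 2 / (b₁ - a₁)) :=
            mul_le_mul_of_nonneg_right (hP.sum_volume_le hab₁.le) hε'.le
        _ = ε / 2 := mul_div_cancel₀ _ hℓ.ne'
    _ = ε := add_halves ε
end
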